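/- arXiv:2506.12999 — 3 statements merged into one kernel-verified Lean document; each statement's English description precedes it below -/
import Mathlib

section
/- Let ℓ be a prime, K a number field, and 𝔓 an ℓ-power-free ideal of 𝒪_K. Suppose γ₁, γ₂ ∈ 𝒪_K are nonzero with γ₁𝒪_K = 𝔍₁^ℓ 𝔓 and γ₂𝒪_K = 𝔍₂^ℓ 𝔓, where 𝔍₁ and 𝔍₂ are ideals of 𝒪_K lying in the same ideal class. Then there exists a unit α ∈ 𝒪_K^× such that K(γ₁^{1/ℓ}) = K((αγ₂)^{1/ℓ}) inside a fixed algebraic closure of K. -/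
open NumberField

noncomputable section

/-- **Reduction lemma.**  Let `ℓ` be prime, `K` a number field and `𝔓` an `ℓ`-power-free
ideal of `𝒪_K`.  If `γ₁𝒪_K = 𝔍₁^ℓ 𝔓` and `γ₂𝒪_K = 𝔍₂^ℓ 𝔓` with `𝔍₁, 𝔍₂` in the same
ideal class, then there is a unit `α ∈ 𝒪_K^×` with `K(γ₁^(1/ℓ)) = K((αγ₂)^(1/ℓ))`
inside a fixed algebraic closure of `K`. -/
theorem kummer_reduction
    (ℓ : ℕ) (hℓ : ℓ.Prime) (K : Type*) [Field K] [NumberField K]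
    (𝔓 : Ideal (𝓞 K))
    (h𝔓 : ∀ I : Ideal (𝓞 K), ¬ IsUnit I → ¬ I ^ ℓ ∣ 𝔓)  -- `𝔓` is `ℓ`-power-free
    (γ₁ γ₂ : 𝓞 K) (hγ₁ : γ₁ ≠ 0) (hγ₂ : γ₂ ≠ 0)
    (𝔍₁ 𝔍₂ : Ideal (𝓞 K))
    (hf₁ : Ideal.span {γ₁} = 𝔍₁ ^ ℓ * 𝔓)
    (hf₂ : Ideal.span {γ₂} = 𝔍₂ ^ ℓ * 𝔓)
    -- `𝔍₁` and `𝔍₂` lie in the same ideal class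
    (hcls : ∃ a b : 𝓞 K, a ≠ 0 ∧ b ≠ 0 ∧
      Ideal.span {a} * 𝔍₁ = Ideal.span {b} * 𝔍₂) :
    ∃ α : (𝓞 K)ˣ, ∃ x y : AlgebraicClosure K,
      x ^ ℓ = algebraMap K (AlgebraicClosure K) (algebraMap (𝓞 K) K γ₁) ∧
      y ^ ℓ = algebraMap K (AlgebraicClosure K) (algebraMap (𝓞 K) K ((α : 𝓞 K) * γ₂)) ∧
      IntermediateField.adjoin K {x} = IntermediateField.adjoin K {y} := by
  obtain ⟨a, b, ha, hb, hab⟩ := hcls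
  have h1 : Ideal.span {b ^ ℓ * γ₂} = Ideal.span {a ^ ℓ * γ₁} := by
    rw [← Ideal.span_singleton_mul_span_singleton, ← Ideal.span_singleton_mul_span_singleton,
      ← Ideal.span_singleton_pow, ← Ideal.span_singleton_pow, hf₁, hf₂, ← mul_assoc, ← mul_assoc,
      ← mul_pow, ← mul_pow, hab]
  obtain ⟨u, hu⟩ := Ideal.span_singleton_eq_span_singleton.mp h1
  obtain ⟨y, hy⟩ := IsAlgClosed.exists_pow_nat_eq
    (algebraMap K (AlgebraicClosure K) (algebraMap (𝓞 K) K ((u : 𝓞 K) * γ₂))) hℓ.pos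
  have ha' : algebraMap (𝓞 K) K a ≠ 0 := by simpa using ha
  have hb' : algebraMap (𝓞 K) K b ≠ 0 := by simpa using hb
  have hA : algebraMap K (AlgebraicClosure K) (algebraMap (𝓞 K) K a) ≠ 0 := by
    rwa [Ne, map_eq_zero]
  have hB : algebraMap K (AlgebraicClosure K) (algebraMap (𝓞 K) K b) ≠ 0 := by
    rwa [Ne, map_eq_zero]
  set c : K := algebraMap (𝓞 K) K b / algebraMap (𝓞 K) K a with hc
  have hc0 : algebraMap K (AlgebraicClosure K) c ≠ 0 := by
    rw [Ne, map_eq_zero]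
    exact div_ne_zero hb' ha'
  refine ⟨u, algebraMap K (AlgebraicClosure K) c * y, y, ?_, hy, ?_⟩
  · rw [mul_pow, hy, ← map_pow, ← map_mul]
    congr 1
    rw [hc, div_pow, div_mul_eq_mul_div, div_eq_iff (pow_ne_zero _ ha'), ← map_pow, ← map_pow,
      ← map_mul, ← map_mul]
    congr 1
    linear_combination hu
  · apply le_antisymm
    · rw [IntermediateField.adjoin_simple_le_iff]
      exact mul_mem (IntermediateField.algebraMap_mem _ c)
        (IntermediateField.mem_adjoin_simple_self K y)
    · rw [IntermediateField.adjoin_simple_le_iff]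
      have h := mul_mem (inv_mem (IntermediateField.algebraMap_mem
        (IntermediateField.adjoin K {algebraMap K (AlgebraicClosure K) c * y}) c))
        (IntermediateField.mem_adjoin_simple_self K (algebraMap K (AlgebraicClosure K) c * y))
      rwa [inv_mul_cancel_left₀ hc0] at h

end
end

section
/- Let K be a number field of degree n over ℚ, let 𝒞 be an ideal class of K with class number h_K, and let Q be a nonzero ideal of 𝒪_K. Then #{𝔍 ⊆ 𝒪_K nonzero ideal : N(𝔍) ≤ X, gcd(𝔍, Q) = 𝒪_K, [𝔍] = 𝒞} = (Res_{s=1} ζ_K(s) / h_K) · ∏_{𝔮 | Q, 𝔮 prime} (1 − 1/N(𝔮)) · X + O(X^{1−1/n}) as X → ∞. -/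
open NumberField Filter
open scoped nonZeroDivisors

noncomputable section

/-- The residue at `s = 1` of the Dedekind zeta function of `K`, given by the analytic
class number formula: `Res_{s=1} ζ_K(s) = 2^{r₁} (2π)^{r₂} h_K Reg_K / (w_K √|d_K|)`. -/
def zetaResidue (K : Type*) [Field K] [NumberField K] : ℝ :=
  (2 ^ InfinitePlace.nrRealPlaces K * (2 * Real.pi) ^ InfinitePlace.nrComplexPlaces K *
      (classNumber K) * Units.regulator K) /
    ((Units.torsionOrder K : ℕ) * Real.sqrt |(NumberField.discr K : ℝ)|)

section ThinSets
open MeasureTheory Metric Module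
open scoped Pointwise

/-- Sets whose `δ`-neighbourhoods have volume `O(δ)`. -/
def ThinSet {E : Type*} [PseudoEMetricSpace E] [MeasurableSpace E] (μ : Measure E) (T : Set E) :
    Prop :=
  ∃ C : ℝ, 0 ≤ C ∧ ∀ δ : ℝ, 0 < δ → δ ≤ 1 → μ (thickening δ T) ≤ ENNReal.ofReal (C * δ)

theorem ThinSet.mono {E : Type*} [PseudoEMetricSpace E] [MeasurableSpace E] {μ : Measure E}
    {T T' : Set E} (h : ThinSet μ T') (hT : T ⊆ T') : ThinSet μ T := by
  obtain ⟨C, hC, h⟩ := h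
  exact ⟨C, hC, fun δ h0 h1 => (measure_mono (thickening_subset_of_subset δ hT)).trans (h δ h0 h1)⟩

theorem ThinSet.iUnion {E : Type*} [PseudoEMetricSpace E] [MeasurableSpace E] {μ : Measure E}
    {ι : Type*} [Finite ι] {T : ι → Set E} (h : ∀ i, ThinSet μ (T i)) : ThinSet μ (⋃ i, T i) := by
  classical
  have := Fintype.ofFinite ι
  choose C hC h using h
  refine ⟨∑ i, C i, Finset.sum_nonneg fun i _ => hC i, fun δ h0 h1 => ?_⟩
  rw [thickening_iUnion, Finset.sum_mul, ENNReal.ofReal_sum_of_nonneg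
    (fun i _ => mul_nonneg (hC i) h0.le)]
  refine (measure_iUnion_fintype_le _ _).trans (Finset.sum_le_sum fun i _ => h i δ h0 h1)

theorem thinSet_image_face {E : Type*} [NormedAddCommGroup E] [NormedSpace ℝ E]
    [FiniteDimensional ℝ E] [MeasurableSpace E] [BorelSpace E] (μ : Measure E)
    [μ.IsAddHaarMeasure] {ι : Type*} [Fintype ι] (hι : Fintype.card ι = finrank ℝ E)
    {f : (ι → ℝ) → E} {M : NNReal} (hf : LipschitzOnWith M f (Set.Icc 0 1)) (i : ι) (a : ℝ)
    (ha : a ∈ Set.Icc (0 : ℝ) 1) :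
    ThinSet μ (f '' {p | p ∈ Set.Icc (0 : ι → ℝ) 1 ∧ p i = a}) := by
  classical
  set n := finrank ℝ E with hn
  have hn1 : 0 < n := by rw [← hι]; exact Fintype.card_pos_iff.mpr ⟨i⟩
  set c : ℝ := μ.real (ball (0 : E) 1) with hc
  have hc' : μ (ball (0 : E) 1) = ENNReal.ofReal c := by
    rw [hc, ofReal_measureReal measure_ball_lt_top.ne]
  have hM : (0 : ℝ) ≤ M := M.2
  have hc0 : 0 ≤ c := measureReal_nonneg
  refine ⟨2 ^ (n - 1) * (M + 1) ^ n * c, by positivity, fun δ h0 h1 => ?_⟩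
  set N := ⌈1 / δ⌉₊ with hN
  have hN1 : 1 / δ ≤ N := Nat.le_ceil _
  have hN2 : (N : ℝ) ≤ 2 / δ := by
    have := (Nat.ceil_lt_add_one (show 0 ≤ 1 / δ by positivity)).le
    have h3 : 1 ≤ 1 / δ := by rw [le_div_iff₀ h0]; linarith
    have : 2 / δ = 1 / δ + 1 / δ := by ring
    linarith
  have hN0 : (0 : ℝ) < N := lt_of_lt_of_le (by positivity) hN1
  have hNδ : 1 / (N : ℝ) ≤ δ := by
    rw [div_le_iff₀ hN0]
    rw [div_le_iff₀ h0] at hN1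
    linarith
  let g : ({j // j ≠ i} → Fin N) → (ι → ℝ) := fun k j =>
    if h : j ≠ i then (k ⟨j, h⟩ : ℝ) / N else a
  have hg : ∀ k, g k ∈ Set.Icc (0 : ι → ℝ) 1 := by
    intro k
    rw [Set.mem_Icc, Pi.le_def, Pi.le_def, ← forall_and]
    intro j
    simp only [g, Pi.zero_apply, Pi.one_apply]
    split_ifs with h
    · refine ⟨by positivity, ?_⟩
      rw [div_le_one hN0]
      exact_mod_cast (k ⟨j, h⟩).2.le
    · exact ha
  have hcov : thickening δ (f '' {p | p ∈ Set.Icc (0 : ι → ℝ) 1 ∧ p i = a}) ⊆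
      ⋃ k, closedBall (f (g k)) ((M + 1) * δ) := by
    intro x hx
    rw [mem_thickening_iff] at hx
    obtain ⟨_, ⟨p, ⟨hp, hpi⟩, rfl⟩, hxp⟩ := hx
    have hNpos : 0 < N := by exact_mod_cast hN0
    let k : {j // j ≠ i} → Fin N := fun j =>
      ⟨min ⌊N * p j⌋₊ (N - 1), by omega⟩
    refine Set.mem_iUnion.mpr ⟨k, ?_⟩
    rw [mem_closedBall]
    have hd : dist p (g k) ≤ 1 / N := by
      rw [dist_pi_le_iff (by positivity)]
      intro j
      simp only [g]
      split_ifs with h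
      · have hp0 : 0 ≤ p j := hp.1 j
        have hp1 : p j ≤ 1 := hp.2 j
        have e1 : ((k ⟨j, h⟩ : ℕ) : ℝ) ≤ N * p j := by
          refine le_trans ?_ (Nat.floor_le (by positivity))
          simp only [k]
          exact_mod_cast min_le_left _ _
        have e2 : (N : ℝ) * p j ≤ (k ⟨j, h⟩ : ℕ) + 1 := by
          simp only [k]
          rcases le_total ⌊(N : ℝ) * p j⌋₊ (N - 1) with h' | h'
          · rw [min_eq_left h']
            exact (Nat.lt_floor_add_one _).le
          · rw [min_eq_right h', Nat.cast_sub hNpos]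
            push_cast
            nlinarith
        rw [Real.dist_eq, abs_le]
        constructor
        · rw [neg_le_sub_iff_le_add, div_le_iff₀ hN0, add_mul, one_div_mul_cancel hN0.ne']
          linarith
        · rw [sub_le_iff_le_add, ← add_div, le_div_iff₀ hN0]
          linarith
      · push Not at h
        rw [h, hpi, dist_self]
        positivity
    have h3 := hf.dist_le_mul p hp (g k) (hg k)
    calc dist x (f (g k)) ≤ dist x (f p) + dist (f p) (f (g k)) := dist_triangle _ _ _
      _ ≤ δ + M * δ := add_le_add hxp.le (h3.trans (mul_le_mul_of_nonneg_left (hd.trans hNδ) hM))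
      _ = (M + 1) * δ := by ring
  refine (measure_mono hcov).trans ((measure_iUnion_fintype_le _ _).trans ?_)
  simp_rw [Measure.addHaar_closedBall μ _ (show 0 ≤ (M + 1) * δ by positivity), hc']
  rw [Finset.sum_const, Finset.card_univ, Fintype.card_fun, Fintype.card_fin,
    Fintype.card_subtype_compl, Fintype.card_subtype_eq, hι, ← hn, nsmul_eq_mul,
    ← ENNReal.ofReal_mul (by positivity), ← ENNReal.ofReal_natCast,
    ← ENNReal.ofReal_mul (by positivity)]
  apply ENNReal.ofReal_le_ofReal
  push_cast
  calc (N : ℝ) ^ (n - 1) * (((M + 1) * δ) ^ n * c)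
      ≤ (2 / δ) ^ (n - 1) * (((M + 1) * δ) ^ n * c) := by gcongr
    _ = 2 ^ (n - 1) * (M + 1) ^ n * c * δ := by
      obtain ⟨m, hm⟩ : ∃ m, n = m + 1 := ⟨n - 1, by omega⟩
      rw [hm, Nat.add_sub_cancel, mul_pow, div_pow, pow_succ δ]
      field_simp

theorem lattice_count {E : Type*} [NormedAddCommGroup E] [NormedSpace ℝ E]
    [FiniteDimensional ℝ E] [MeasurableSpace E] [BorelSpace E] (μ : Measure E)
    [μ.IsAddHaarMeasure] (L : Submodule ℤ E) [DiscreteTopology L] [IsZLattice ℝ L]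
    {S : Set E} (hS : Bornology.IsBounded S) (hthin : ThinSet μ (frontier S)) :
    ∃ C T : ℝ, 0 < T ∧ ∀ t : ℝ, T ≤ t →
      |(Nat.card {x : E // x ∈ L ∧ t⁻¹ • x ∈ S} : ℝ) -
        t ^ finrank ℝ E * μ.real S / ZLattice.covolume L μ| ≤ C * (t ^ finrank ℝ E / t) := by
  classical
  obtain ⟨C₀, hC₀, hthin⟩ := hthin
  have : Module.Free ℤ L := ZLattice.module_free ℝ L
  have : Module.Finite ℤ L := ZLattice.module_finite ℝ L
  let b₀ := Free.chooseBasis ℤ L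
  let b := b₀.ofZLatticeBasis ℝ L
  have hspan : Submodule.span ℤ (Set.range b) = L := b₀.ofZLatticeBasis_span ℝ L
  let F := ZSpan.fundamentalDomain b
  have hF : Bornology.IsBounded F := ZSpan.fundamentalDomain_isBounded b
  have hcov : ZLattice.covolume L μ = μ.real F :=
    ZLattice.covolume_eq_measure_fundamentalDomain L μ (ZLattice.isAddFundamentalDomain b₀ μ)
  have hcpos := ZLattice.covolume_pos L μ
  obtain ⟨D₀, hD₀⟩ := hF.exists_norm_le
  set D := max D₀ 0 + 1 with hDdef
  have hDpos : 0 < D := by positivity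
  have hD : ∀ x ∈ F, ‖x‖ < D := fun x hx => by
    have := hD₀ x hx
    have := le_max_left D₀ 0
    linarith
  refine ⟨C₀ * D / ZLattice.covolume L μ, D, hDpos, fun t ht => ?_⟩
  have ht0 : 0 < t := hDpos.trans_le ht
  set n := finrank ℝ E with hn
  set A : Set E := {x | x ∈ L ∧ t⁻¹ • x ∈ S} with hA
  let W : Set E := {z | t⁻¹ • (ZSpan.floor b z : E) ∈ S}
  let V : Set E := {u | t • u ∈ W}
  have hfin : A.Finite := by
    have hb : Bornology.IsBounded (t • S) := hS.smul₀ t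
    have h1 := ZSpan.setFinite_inter b hb
    refine h1.subset fun x hx => ⟨?_, ?_⟩
    · exact ⟨t⁻¹ • x, hx.2, by simp [smul_smul, ht0.ne']⟩
    · rw [hspan]; exact hx.1
  have hW : W = ⋃ l ∈ hfin.toFinset, (fun z => -l + z) ⁻¹' F := by
    ext z
    simp only [W, Set.mem_ofPred_eq, Set.mem_iUnion, Set.Finite.mem_toFinset, Set.mem_preimage,
      exists_prop]
    constructor
    · intro hz
      refine ⟨ZSpan.floor b z, ⟨?_, hz⟩, ?_⟩
      · exact hspan.le (ZSpan.floor b z).2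
      · have := ZSpan.fract_mem_fundamentalDomain b z
        rw [ZSpan.fract_apply] at this
        rwa [neg_add_eq_sub]
    · rintro ⟨l, hl, hz⟩
      have hl' : l ∈ Submodule.span ℤ (Set.range b) := by rw [hspan]; exact hl.1
      have h1 : ZSpan.fract b (-l + z) = -l + z := ZSpan.fract_eq_self.mpr hz
      have h2 : ZSpan.fract b (-l + z) = ZSpan.fract b z := ZSpan.fract_zSpan_add b z (neg_mem hl')
      have h3 : (ZSpan.floor b z : E) = l := by
        have := ZSpan.fract_apply b z
        rw [← h2, h1] at this
        have h4 : (ZSpan.floor b z : E) = z - (-l + z) := by rw [this]; abel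
        rw [h4]; abel
      rw [h3]; exact hl.2
  have hFm : MeasurableSet F := ZSpan.fundamentalDomain_measurableSet b
  have hμW : μ W = hfin.toFinset.card * μ F := by
    rw [hW, measure_biUnion_finset]
    · simp_rw [measure_preimage_add]
      rw [Finset.sum_const, nsmul_eq_mul]
    · intro l hl l' hl' hne
      refine Set.disjoint_left.mpr fun z hz hz' => hne ?_
      have hl1 : l ∈ Submodule.span ℤ (Set.range b) := by
        rw [hspan]; exact (hfin.mem_toFinset.mp hl).1
      have hl2 : l' ∈ Submodule.span ℤ (Set.range b) := by
        rw [hspan]; exact (hfin.mem_toFinset.mp hl').1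
      have h1 : ZSpan.fract b (-l + z) = -l + z := ZSpan.fract_eq_self.mpr hz
      have h2 : ZSpan.fract b (-l + z) = ZSpan.fract b z := ZSpan.fract_zSpan_add b z (neg_mem hl1)
      have h1' : ZSpan.fract b (-l' + z) = -l' + z := ZSpan.fract_eq_self.mpr hz'
      have h2' : ZSpan.fract b (-l' + z) = ZSpan.fract b z :=
        ZSpan.fract_zSpan_add b z (neg_mem hl2)
      have : -l + z = -l' + z := by rw [← h1, ← h1', h2, h2']
      simpa using this
    · intro l _
      exact hFm.preimage (measurable_const_add _)
  have hVW : W = t • V := by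
    ext z
    rw [Set.mem_smul_set_iff_inv_smul_mem₀ ht0.ne']
    simp only [V, Set.mem_ofPred_eq, smul_smul, mul_inv_cancel₀ ht0.ne', one_smul]
  have hμF : μ F ≠ ⊤ := hF.measure_lt_top.ne
  have hWr : (Nat.card {x : E // x ∈ L ∧ t⁻¹ • x ∈ S} : ℝ) * ZLattice.covolume L μ =
      t ^ n * μ.real V := by
    have h1 : μ.real W = t ^ n * μ.real V := by
      rw [hVW, measureReal_def, Measure.addHaar_smul, ENNReal.toReal_mul, ← measureReal_def,
        ENNReal.toReal_ofReal (abs_nonneg _), abs_of_nonneg (by positivity)]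
    have h2 : Nat.card {x : E // x ∈ L ∧ t⁻¹ • x ∈ S} = hfin.toFinset.card := by
      rw [← Set.ncard_eq_toFinset_card A hfin]
      rfl
    rw [h2, ← h1, hcov, measureReal_def, measureReal_def, hμW, ENNReal.toReal_mul,
      ENNReal.toReal_natCast]
  have hVfin : μ V ≠ ⊤ := by
    have h1 : μ W ≠ ⊤ := by
      rw [hμW]; exact ENNReal.mul_ne_top (ENNReal.natCast_ne_top _) hμF
    rw [hVW, Measure.addHaar_smul] at h1
    intro h
    rw [h, ENNReal.mul_top] at h1
    · exact h1 rfl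
    · simp [ht0.ne']
  have hSfin : μ S ≠ ⊤ := hS.measure_lt_top.ne
  have hδ : D / t ≤ 1 := (div_le_one ht0).mpr ht
  have hδ0 : 0 < D / t := by positivity
  -- key: points in the symmetric difference are near the frontier
  have hpt : ∀ u : E, dist u (t⁻¹ • (ZSpan.floor b (t • u) : E)) < D / t := by
    intro u
    have h1 : u - t⁻¹ • (ZSpan.floor b (t • u) : E) = t⁻¹ • ZSpan.fract b (t • u) := by
      rw [ZSpan.fract_apply, smul_sub, smul_smul, inv_mul_cancel₀ ht0.ne', one_smul]
    rw [dist_eq_norm, h1, norm_smul, norm_inv, Real.norm_of_nonneg ht0.le, div_eq_inv_mul]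
    exact mul_lt_mul_of_pos_left (hD _ (ZSpan.fract_mem_fundamentalDomain b _)) (by positivity)
  have hfr : ∀ u v : E, u ∈ S → v ∉ S → ∃ y ∈ frontier S, dist u y ≤ dist u v := by
    intro u v hu hv
    obtain ⟨y, hy, h⟩ := exists_mem_frontier_infDist_compl_eq_dist hu
      (fun h => hv (h ▸ Set.mem_univ v))
    exact ⟨y, hy, h ▸ infDist_le_dist_of_mem hv⟩
  have hfr' : ∀ u v : E, u ∉ S → v ∈ S → ∃ y ∈ frontier S, dist u y ≤ dist u v := by
    intro u v hu hv
    obtain ⟨y, hy, h⟩ := exists_mem_frontier_infDist_compl_eq_dist (s := Sᶜ) hu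
      (fun h => by have := h ▸ Set.mem_univ v; exact this hv)
    rw [frontier_compl] at hy
    exact ⟨y, hy, h ▸ infDist_le_dist_of_mem (by rwa [compl_compl])⟩
  have hVS : V ⊆ S ∪ thickening (D / t) (frontier S) := by
    intro u hu
    by_cases huS : u ∈ S
    · exact Or.inl huS
    · right
      obtain ⟨y, hy, h⟩ := hfr' u _ huS hu
      exact mem_thickening_iff.mpr ⟨y, hy, h.trans_lt (hpt u)⟩
  have hSV : S ⊆ V ∪ thickening (D / t) (frontier S) := by
    intro u hu
    by_cases huV : u ∈ V
    · exact Or.inl huV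
    · right
      obtain ⟨y, hy, h⟩ := hfr u (t⁻¹ • (ZSpan.floor b (t • u) : E)) hu huV
      exact mem_thickening_iff.mpr ⟨y, hy, h.trans_lt (hpt u)⟩
  have hth := hthin (D / t) hδ0 hδ
  have hthfin : μ (thickening (D / t) (frontier S)) ≠ ⊤ :=
    (hth.trans_lt ENNReal.ofReal_lt_top).ne
  have hthr : μ.real (thickening (D / t) (frontier S)) ≤ C₀ * (D / t) := by
    rw [measureReal_def]
    exact ENNReal.toReal_le_of_le_ofReal (by positivity) hth
  have k1 : μ.real V ≤ μ.real S + C₀ * (D / t) :=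
    ((measureReal_mono hVS (measure_union_ne_top hSfin hthfin)).trans
      (measureReal_union_le _ _)).trans (by gcongr)
  have k2 : μ.real S ≤ μ.real V + C₀ * (D / t) :=
    ((measureReal_mono hSV (measure_union_ne_top hVfin hthfin)).trans
      (measureReal_union_le _ _)).trans (by gcongr)
  have k3 : |μ.real V - μ.real S| ≤ C₀ * (D / t) := abs_le.mpr ⟨by linarith, by linarith⟩
  have k4 : (Nat.card {x : E // x ∈ L ∧ t⁻¹ • x ∈ S} : ℝ) -
        t ^ n * μ.real S / ZLattice.covolume L μ =
      t ^ n / ZLattice.covolume L μ * (μ.real V - μ.real S) := by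
    rw [eq_div_of_mul_eq hcpos.ne' hWr]
    ring
  rw [k4, abs_mul, abs_of_nonneg (by positivity)]
  refine (mul_le_mul_of_nonneg_left k3 (by positivity)).trans (le_of_eq ?_)
  ring

end ThinSets
section FrontierThin
open MeasureTheory Metric Module NumberField.InfinitePlace NumberField.mixedEmbedding
  NumberField.mixedEmbedding.fundamentalCone NumberField.Units NumberField.Units.dirichletUnitTheorem
open scoped Classical Pointwise

variable (K : Type*) [Field K] [NumberField K]

/-- Parameter index type. -/
abbrev PIdx := InfinitePlace K ⊕ {w : InfinitePlace K // IsComplex w}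

variable {K} in
/-- The absolute values part of the parametrization. -/
def paramAbs (p : PIdx K → ℝ) : realSpace K :=
  p (Sum.inl w₀) • expMapBasis (fun w : InfinitePlace K => if w = w₀ then 0 else p (Sum.inl w))

variable {K} in
/-- The parametrization of the set of elements of the cone of norm at most one. -/
def paramMap (σ : {w : InfinitePlace K // IsReal w} → Bool) (p : PIdx K → ℝ) : mixedSpace K :=
  (fun w => (if σ w then 1 else -1) * paramAbs p w.1,
    fun w => (paramAbs p w.1 : ℂ) * Complex.exp (2 * Real.pi * p (Sum.inr w) * Complex.I))

theorem contDiff_paramAbs : ContDiff ℝ 1 (paramAbs (K := K)) := by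
  have h0 : ContDiff ℝ 1 (fun p : PIdx K → ℝ =>
      (fun w : InfinitePlace K => if w = w₀ then 0 else p (Sum.inl w))) := by
    refine contDiff_pi.mpr fun w => ?_
    split_ifs
    · exact contDiff_const
    · exact contDiff_apply ℝ ℝ _
  have h1 : ContDiff ℝ 1 (fun x : realSpace K => (expMapBasis x : realSpace K)) := by
    refine contDiff_pi.mpr fun w => ?_
    simp_rw [expMapBasis_apply, expMap_apply]
    refine Real.contDiff_exp.comp (contDiff_const.mul ?_)
    have : ContDiff ℝ 1 (fun x : realSpace K => (completeBasis K).equivFunL.symm x) :=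
      (completeBasis K).equivFunL.symm.contDiff
    exact (contDiff_apply ℝ ℝ w).comp this
  exact (contDiff_apply ℝ ℝ _).smul (h1.comp h0)

theorem contDiff_paramMap (σ : {w : InfinitePlace K // IsReal w} → Bool) :
    ContDiff ℝ 1 (paramMap σ) := by
  have h := contDiff_paramAbs K
  refine ContDiff.prodMk (contDiff_pi.mpr fun w => ?_) (contDiff_pi.mpr fun w => ?_)
  · exact contDiff_const.mul ((contDiff_apply ℝ ℝ _).comp h)
  · refine ContDiff.mul (Complex.ofRealCLM.contDiff.comp ((contDiff_apply ℝ ℝ _).comp h)) ?_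
    refine ContDiff.cexp ?_
    refine ContDiff.mul (ContDiff.mul contDiff_const ?_) contDiff_const
    exact Complex.ofRealCLM.contDiff.comp (contDiff_apply ℝ ℝ _)

theorem card_PIdx : Fintype.card (PIdx K) = finrank ℝ (mixedSpace K) := by
  rw [mixedEmbedding.finrank, Fintype.card_sum, card_eq_nrRealPlaces_add_nrComplexPlaces,
    ← card_add_two_mul_card_eq_rank]
  have : Fintype.card {w : InfinitePlace K // IsComplex w} = nrComplexPlaces K := by
    rw [nrComplexPlaces]
  rw [this]
  ring

theorem frontier_normLeOne_subset : frontier (normLeOne K) ⊆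
    ⋃ x : ({w : InfinitePlace K // IsReal w} → Bool) × PIdx K × Bool,
      paramMap x.1 '' {p | p ∈ Set.Icc (0 : PIdx K → ℝ) 1 ∧ p x.2.1 = if x.2.2 then 1 else 0} := by
  intro x hx
  obtain ⟨c, hc, _, ⟨y, hy, rfl⟩, hxy⟩ := closure_normLeOne_subset K hx.1
  have hy0 : y w₀ = 0 := by simpa using hy w₀ (Set.mem_univ _)
  have hy1 : ∀ w, w ≠ w₀ → y w ∈ Set.Icc (0 : ℝ) 1 := fun w hw => by
    simpa [hw] using hy w (Set.mem_univ _)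
  simp only at hxy
  -- choose the arguments
  have harg : ∀ w : {w : InfinitePlace K // IsComplex w}, ∃ θ ∈ Set.Icc (0 : ℝ) 1,
      x.2 w = (‖x.2 w‖ : ℂ) * Complex.exp (2 * Real.pi * θ * Complex.I) := by
    intro w
    refine ⟨toIcoMod Real.two_pi_pos 0 (Complex.arg (x.2 w)) / (2 * Real.pi), ?_, ?_⟩
    · have := toIcoMod_mem_Ico Real.two_pi_pos 0 (Complex.arg (x.2 w))
      rw [zero_add] at this
      exact ⟨div_nonneg this.1 Real.two_pi_pos.le,
        (div_le_one Real.two_pi_pos).mpr this.2.le⟩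
    · conv_lhs => rw [← Complex.norm_mul_exp_arg_mul_I (x.2 w)]
      congr 1
      have h2 : (2 * (Real.pi : ℂ)) ≠ 0 := by
        exact_mod_cast Real.two_pi_pos.ne'
      rw [toIcoMod]
      push_cast
      rw [mul_div_cancel₀ _ h2]
      rw [Complex.exp_eq_exp_iff_exists_int]
      refine ⟨toIcoDiv Real.two_pi_pos 0 (Complex.arg (x.2 w)), ?_⟩
      simp only [zsmul_eq_mul]
      push_cast
      ring
  choose θ hθ hxθ using harg
  let p : PIdx K → ℝ := Sum.elim (fun w => if w = w₀ then c else y w) θ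
  have hp : p ∈ Set.Icc (0 : PIdx K → ℝ) 1 := by
    rw [Set.mem_Icc, Pi.le_def, Pi.le_def, ← forall_and]
    rintro (w | w)
    · simp only [p, Sum.elim_inl, Pi.zero_apply, Pi.one_apply]
      split_ifs with h
      · exact hc
      · exact hy1 w h
    · exact hθ w
  have hpabs : paramAbs p = normAtAllPlaces x := by
    rw [← hxy, paramAbs]
    simp only [p, Sum.elim_inl, if_true]
    congr 2
    ext w
    split_ifs with h
    · rw [h, hy0]
    · rfl
  let σ : {w : InfinitePlace K // IsReal w} → Bool := fun w => decide (0 ≤ x.1 w)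
  have hpx : paramMap σ p = x := by
    refine Prod.ext (funext fun w => ?_) (funext fun w => ?_)
    · simp only [paramMap, hpabs, normAtAllPlaces_apply, normAtPlace_apply_of_isReal w.2, σ,
        decide_eq_true_eq, Real.norm_eq_abs]
      split_ifs with h
      · rw [abs_of_nonneg h, one_mul]
      · rw [abs_of_neg (not_le.mp h)]; ring
    · simp only [paramMap, hpabs, normAtAllPlaces_apply, normAtPlace_apply_of_isComplex w.2]
      exact (hxθ w).symm
  suffices h : ∃ w : InfinitePlace K, p (Sum.inl w) = 0 ∨ p (Sum.inl w) = 1 by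
    obtain ⟨w, h | h⟩ := h
    · exact Set.mem_iUnion.mpr ⟨(σ, Sum.inl w, false), p, ⟨hp, by simpa using h⟩, hpx⟩
    · exact Set.mem_iUnion.mpr ⟨(σ, Sum.inl w, true), p, ⟨hp, by simpa using h⟩, hpx⟩
  by_contra! hne
  apply hx.2
  apply subset_interior_normLeOne K
  have hioo : ∀ w : InfinitePlace K, p (Sum.inl w) ∈ Set.Ioo (0 : ℝ) 1 := fun w =>
    ⟨lt_of_le_of_ne (hp.1 _) (hne w).1.symm, lt_of_le_of_ne (hp.2 _) (hne w).2⟩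
  have hc' : c ∈ Set.Ioo (0 : ℝ) 1 := by simpa [p] using hioo w₀
  refine ⟨fun w => if w = w₀ then Real.log c else y w, ?_, ?_⟩
  · rw [interior_paramSet, Set.mem_univ_pi]
    intro w
    split_ifs with h
    · exact Real.log_neg hc'.1 hc'.2
    · simpa [p, h] using hioo w
  · rw [expMapBasis_apply'', if_pos rfl, Real.exp_log hc'.1, ← hxy]
    congr 2
    ext w
    split_ifs with h
    · rw [h, hy0]
    · rfl

theorem thinSet_frontier_normLeOne : ThinSet volume (frontier (normLeOne K)) := by
  refine ThinSet.mono (ThinSet.iUnion fun x => ?_) (frontier_normLeOne_subset K)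
  have hc : IsCompact (Set.Icc (0 : PIdx K → ℝ) 1) := isCompact_Icc
  obtain ⟨M, hM⟩ := LocallyLipschitzOn.exists_lipschitzOnWith_of_compact hc
    (contDiff_paramMap K x.1).locallyLipschitz.locallyLipschitzOn
  refine thinSet_image_face volume (card_PIdx K) hM _ _ ?_
  split_ifs <;> simp

end FrontierThin
section ClassCount
open MeasureTheory Metric Module NumberField.InfinitePlace NumberField.mixedEmbedding
  NumberField.mixedEmbedding.fundamentalCone NumberField.Units Ideal Asymptotics

variable (K : Type*) [Field K] [NumberField K]

theorem card_class_aux {C : ClassGroup (𝓞 K)} {J : (Ideal (𝓞 K))⁰} {s : ℝ}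
    (hJ : ClassGroup.mk0 J = C⁻¹) :
    Nat.card {I : (Ideal (𝓞 K))⁰ // absNorm (I : Ideal (𝓞 K)) ≤ s ∧ ClassGroup.mk0 I = C}
      = Nat.card {I : (Ideal (𝓞 K))⁰ // (J : Ideal (𝓞 K)) ∣ I ∧
        Submodule.IsPrincipal (I : Ideal (𝓞 K)) ∧
        absNorm (I : Ideal (𝓞 K)) ≤ s * absNorm (J : Ideal (𝓞 K))} := by
  simp_rw [← nonZeroDivisors_dvd_iff_dvd_coe]
  refine Nat.card_congr ?_
  refine ((Equiv.dvd J).subtypeEquiv fun I ↦ ?_).trans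
    (Equiv.subtypeSubtypeEquivSubtypeInter (fun I : (Ideal (𝓞 K))⁰ ↦ J ∣ I) _)
  rw [← ClassGroup.mk0_eq_one_iff (SetLike.coe_mem _)]
  simp_rw [Equiv.dvd_apply, Submonoid.coe_mul, ← Submonoid.mul_def, _root_.map_mul, hJ,
    inv_mul_eq_one, Nat.cast_mul, mul_comm s, eq_comm, and_comm, and_congr_left_iff]
  exact fun _ ↦
    (mul_le_mul_iff_of_pos_left (Nat.cast_pos.mpr (absNorm_pos_of_nonZeroDivisors J))).symm

theorem card_idealSet_eq (J : (Ideal (𝓞 K))⁰) {t : ℝ} (ht : 0 < t) :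
    Nat.card {a : idealSet K J // mixedEmbedding.norm (a : mixedSpace K) ≤ t ^ finrank ℚ K} =
    Nat.card {x : mixedSpace K // x ∈ mixedEmbedding.idealLattice K (FractionalIdeal.mk0 K J) ∧
      t⁻¹ • x ∈ normLeOne K} := by
  refine Nat.card_congr ((Equiv.subtypeSubtypeEquivSubtypeInter (fun x => x ∈ idealSet K J)
    (fun x => mixedEmbedding.norm x ≤ t ^ finrank ℚ K)).trans (Equiv.subtypeEquivRight fun x => ?_))
  rw [idealSet, mem_normLeOne, smul_mem_iff_mem (inv_ne_zero ht.ne'), mixedEmbedding.norm_smul,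
    abs_of_pos (inv_pos.mpr ht), inv_pow, inv_mul_le_one₀ (by positivity), Set.mem_inter_iff]
  simp only [SetLike.mem_coe]
  tauto

theorem class_count (C : ClassGroup (𝓞 K)) :
    (fun X : ℝ => (Nat.card {I : (Ideal (𝓞 K))⁰ //
        absNorm (I : Ideal (𝓞 K)) ≤ X ∧ ClassGroup.mk0 I = C} : ℝ) -
        zetaResidue K / classNumber K * X) =O[atTop]
      fun X : ℝ => X ^ ((1 : ℝ) - 1 / (finrank ℚ K : ℝ)) := by
  classical
  obtain ⟨J, hJ⟩ := ClassGroup.mk0_surjective C⁻¹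
  set N : ℝ := ((absNorm (J : Ideal (𝓞 K)) : ℕ) : ℝ) with hN
  have hN0 : 0 < N := Nat.cast_pos.mpr (absNorm_pos_of_nonZeroDivisors J)
  set n := finrank ℚ K with hn
  have hn0 : 0 < n := finrank_pos
  have hn0' : (n : ℝ) ≠ 0 := by positivity
  obtain ⟨D, T, hT, h⟩ := lattice_count volume
    (mixedEmbedding.idealLattice K (FractionalIdeal.mk0 K J)) (isBounded_normLeOne K)
    (thinSet_frontier_normLeOne K)
  rw [mixedEmbedding.finrank, ← hn] at h
  set w : ℝ := ((torsionOrder K : ℕ) : ℝ) with hw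
  have hw0 : 0 < w := Nat.cast_pos.mpr (Nat.pos_of_ne_zero (torsionOrder_ne_zero K))
  have hh0 : (classNumber K : ℝ) ≠ 0 := by
    exact_mod_cast (classNumber_ne_zero K)
  have hd0 : 0 < √|(discr K : ℝ)| := Real.sqrt_pos.mpr (abs_pos.mpr (by
    exact_mod_cast discr_ne_zero K))
  have hmain : N * volume.real (normLeOne K) /
      ZLattice.covolume (mixedEmbedding.idealLattice K (FractionalIdeal.mk0 K J)) / w =
      zetaResidue K / classNumber K := by
    rw [measureReal_def, volume_normLeOne, covolume_idealLattice, ENNReal.toReal_mul,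
      ENNReal.toReal_mul, ENNReal.toReal_pow, ENNReal.toReal_pow, ENNReal.toReal_ofNat,
      ENNReal.coe_toReal, NNReal.coe_real_pi, ENNReal.toReal_ofReal (regulator_pos K).le,
      FractionalIdeal.coe_mk0, FractionalIdeal.coeIdeal_absNorm, Rat.cast_natCast, zetaResidue,
      ← hw, ← hN, inv_pow]
    field_simp
    rw [mul_pow]
    ring
  refine IsBigO.of_bound (D * N ^ (1 - 1 / (n : ℝ)) / w) ?_
  filter_upwards [eventually_gt_atTop 0, eventually_ge_atTop (T ^ n / N)] with X hX0 hXT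
  have hXN : 0 < X * N := by positivity
  set t : ℝ := (X * N) ^ (1 / (n : ℝ)) with htdef
  have ht0 : 0 < t := by positivity
  have htn : t ^ n = X * N := by
    rw [htdef, ← Real.rpow_natCast, ← Real.rpow_mul hXN.le, one_div, inv_mul_cancel₀ hn0',
      Real.rpow_one]
  have hTt : T ≤ t := by
    refine le_of_pow_le_pow_left₀ hn0.ne' ht0.le ?_
    rw [htn]
    exact (div_le_iff₀ hN0).mp hXT
  have h1 := h t hTt
  rw [← card_idealSet_eq K J ht0, ← hn, htn, ← card_isPrincipal_dvd_norm_le,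
    ← card_class_aux K hJ] at h1
  rw [Nat.cast_mul, ← hw] at h1
  set c : ℝ := (Nat.card {I : (Ideal (𝓞 K))⁰ //
        absNorm (I : Ideal (𝓞 K)) ≤ X ∧ ClassGroup.mk0 I = C} : ℝ) with hcdef
  have h2 : c - zetaResidue K / classNumber K * X = (c * w - X * N * volume.real (normLeOne K) /
      ZLattice.covolume (mixedEmbedding.idealLattice K (FractionalIdeal.mk0 K J))) / w := by
    rw [← hmain]
    field_simp
  have h3 : X * N / t = X ^ (1 - 1 / (n : ℝ)) * N ^ (1 - 1 / (n : ℝ)) := by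
    rw [← Real.mul_rpow hX0.le hN0.le, Real.rpow_sub hXN, Real.rpow_one]
  rw [Real.norm_eq_abs, h2, abs_div, abs_of_pos hw0, Real.norm_of_nonneg (by positivity),
    div_le_iff₀ hw0]
  refine h1.trans (le_of_eq ?_)
  rw [h3]
  field_simp

/-- Ideals in a class, of bounded norm, not divisible by any element of `P`. -/
def sieveSet (P : Finset (Ideal (𝓞 K))) (C : ClassGroup (𝓞 K)) (X : ℝ) : Set (Ideal (𝓞 K))⁰ :=
  {I | (absNorm (I : Ideal (𝓞 K)) ≤ X ∧ ClassGroup.mk0 I = C) ∧ ∀ p ∈ P, ¬ p ∣ (I : Ideal (𝓞 K))}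

theorem sieveSet_finite (P : Finset (Ideal (𝓞 K))) (C : ClassGroup (𝓞 K)) (X : ℝ) :
    (sieveSet K P C X).Finite := by
  rcases lt_or_ge X 0 with hX | hX
  · refine (Set.finite_empty).subset fun I hI => ?_
    have h1 := hI.1.1
    have : (0 : ℝ) ≤ absNorm (I : Ideal (𝓞 K)) := by positivity
    linarith
  · have : Set.Finite {I : (Ideal (𝓞 K))⁰ | absNorm (I : Ideal (𝓞 K)) ≤ ⌊X⌋₊} :=
      finite_setOfPred_absNorm_le₀ ⌊X⌋₊
    exact this.subset fun I hI => (Nat.le_floor hI.1.1)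

theorem sieve_insert [DecidableEq (Ideal (𝓞 K))]
    (P : Finset (Ideal (𝓞 K))) (q : (Ideal (𝓞 K))⁰) (hq : Prime (q : Ideal (𝓞 K)))
    (hP : ∀ p ∈ P, Prime p) (hqP : (q : Ideal (𝓞 K)) ∉ P) (C : ClassGroup (𝓞 K)) (X : ℝ) :
    ((sieveSet K (insert (q : Ideal (𝓞 K)) P) C X).ncard : ℝ) =
      (sieveSet K P C X).ncard -
        (sieveSet K P (C * (ClassGroup.mk0 q)⁻¹) (X / absNorm (q : Ideal (𝓞 K)))).ncard := by
  have hq0 : (0 : ℝ) < absNorm (q : Ideal (𝓞 K)) :=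
    Nat.cast_pos.mpr (absNorm_pos_of_nonZeroDivisors q)
  have hdisj : Disjoint (sieveSet K (insert (q : Ideal (𝓞 K)) P) C X)
      ((fun I => q * I) '' sieveSet K P (C * (ClassGroup.mk0 q)⁻¹)
        (X / absNorm (q : Ideal (𝓞 K)))) := by
    rw [Set.disjoint_left]
    rintro I hI ⟨I', hI', rfl⟩
    exact hI.2 q (Finset.mem_insert_self _ _) (by simp)
  have hunion : sieveSet K (insert (q : Ideal (𝓞 K)) P) C X ∪
      ((fun I => q * I) '' sieveSet K P (C * (ClassGroup.mk0 q)⁻¹)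
        (X / absNorm (q : Ideal (𝓞 K)))) = sieveSet K P C X := by
    have key : ∀ I' : (Ideal (𝓞 K))⁰, I' ∈ sieveSet K P (C * (ClassGroup.mk0 q)⁻¹)
        (X / absNorm (q : Ideal (𝓞 K))) ↔ q * I' ∈ sieveSet K P C X := by
      intro I'
      simp only [sieveSet, Set.mem_ofPred_eq, Submonoid.coe_mul, _root_.map_mul, Nat.cast_mul]
      refine and_congr (and_congr ?_ ?_) (forall₂_congr fun p hp => not_congr ?_)
      · rw [le_div_iff₀ hq0, mul_comm]
      · rw [eq_mul_inv_iff_mul_eq, mul_comm]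
      · rw [(hP p hp).dvd_mul]
        refine ⟨Or.inr, fun h => h.resolve_left fun hpq => hqP ?_⟩
        have := (hP p hp).associated_of_dvd hq hpq
        rw [associated_iff_eq] at this
        exact this ▸ hp
    ext I
    constructor
    · rintro (hI | ⟨I', hI', rfl⟩)
      · exact ⟨hI.1, fun p hp => hI.2 p (Finset.mem_insert_of_mem hp)⟩
      · exact (key I').mp hI'
    · intro hI
      by_cases hqI : (q : Ideal (𝓞 K)) ∣ I
      · right
        rw [← nonZeroDivisors_dvd_iff_dvd_coe] at hqI
        obtain ⟨I', rfl⟩ := hqI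
        exact ⟨I', (key I').mpr hI, rfl⟩
      · left
        refine ⟨hI.1, fun p hp => ?_⟩
        rcases Finset.mem_insert.mp hp with rfl | hp
        · exact hqI
        · exact hI.2 p hp
  rw [← hunion, Set.ncard_union_eq hdisj (sieveSet_finite K _ _ _)
    ((sieveSet_finite K _ _ _).image _), Set.ncard_image_of_injective _ (mul_right_injective q)]
  push_cast
  ring

theorem sieve_count (P : Finset (Ideal (𝓞 K))) (hP : ∀ p ∈ P, Prime p) (C : ClassGroup (𝓞 K)) :
    (fun X : ℝ => ((sieveSet K P C X).ncard : ℝ) -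
        zetaResidue K / classNumber K * (∏ p ∈ P, (1 - 1 / (absNorm p : ℝ))) * X) =O[atTop]
      fun X : ℝ => X ^ ((1 : ℝ) - 1 / (finrank ℚ K : ℝ)) := by
  classical
  induction P using Finset.induction_on generalizing C with
  | empty =>
    refine (class_count K C).congr_left fun X => ?_
    simp only [Finset.prod_empty, mul_one]
    congr 2
    rw [← Nat.card_coe_set_eq]
    refine Nat.card_congr (Equiv.subtypeEquivRight fun I => ?_)
    simp [sieveSet]
  | insert q P hqP ih =>
    have hP' : ∀ p ∈ P, Prime p := fun p hp => hP p (Finset.mem_insert_of_mem hp)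
    have hq : Prime q := hP q (Finset.mem_insert_self _ _)
    let q' : (Ideal (𝓞 K))⁰ := ⟨q, mem_nonZeroDivisors_of_ne_zero hq.ne_zero⟩
    have hq0 : (0 : ℝ) < absNorm q :=
      Nat.cast_pos.mpr (absNorm_pos_of_nonZeroDivisors q')
    have h1 := ih hP' C
    have h2 := (ih hP' (C * (ClassGroup.mk0 q')⁻¹)).comp_tendsto
      (tendsto_id.atTop_div_const hq0)
    have h3 : ((fun X : ℝ => X ^ ((1 : ℝ) - 1 / (finrank ℚ K : ℝ))) ∘ fun X => id X / absNorm q)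
        =O[atTop] fun X : ℝ => X ^ ((1 : ℝ) - 1 / (finrank ℚ K : ℝ)) := by
      refine IsBigO.of_bound (((absNorm q : ℝ) ^ ((1 : ℝ) - 1 / (finrank ℚ K : ℝ)))⁻¹) ?_
      filter_upwards [eventually_ge_atTop 0] with X hX
      simp only [Function.comp, id]
      rw [Real.div_rpow hX hq0.le, norm_div, div_eq_inv_mul,
        Real.norm_of_nonneg (show 0 ≤ (absNorm q : ℝ) ^ ((1 : ℝ) - 1 / (finrank ℚ K : ℝ)) by positivity)]
    refine (h1.sub (h2.trans h3)).congr_left fun X => ?_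
    have h4 := sieve_insert K P q' hq hP' hqP C X
    simp only [q'] at h4
    rw [h4, Finset.prod_insert hqP]
    simp only [Function.comp, id, q']
    ring

end ClassCount

/-- **Counting ideals in a fixed class coprime to `Q`.**
Let `K` be a number field of degree `n`, `𝒞` an ideal class of `K` and `Q` a nonzero
ideal of `𝒪_K`.  Then the number of nonzero ideals `𝔍` of `𝒪_K` with `N(𝔍) ≤ X`,
`gcd(𝔍, Q) = 𝒪_K` and `[𝔍] = 𝒞` equals
`(Res_{s=1} ζ_K(s) / h_K) ∏_{𝔮 ∣ Q} (1 - 1/N(𝔮)) · X + O(X^{1-1/n})`. -/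
theorem ideal_count_in_class_coprime
    (K : Type*) [Field K] [NumberField K] (𝒞 : ClassGroup (𝓞 K))
    (Q : Ideal (𝓞 K)) (hQ : Q ≠ 0) :
    (fun X : ℝ =>
      (Nat.card {J : Ideal (𝓞 K) // J ≠ 0 ∧ (Ideal.absNorm J : ℝ) ≤ X ∧
        IsCoprime J Q ∧
        ∃ h : J ∈ (Ideal (𝓞 K))⁰, ClassGroup.mk0 ⟨J, h⟩ = 𝒞} : ℝ) -
      (zetaResidue K / (classNumber K)) *
        (∏ᶠ q ∈ {q : Ideal (𝓞 K) | q.IsPrime ∧ q ∣ Q},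
          (1 - 1 / (Ideal.absNorm q : ℝ))) * X)
      =O[atTop] fun X : ℝ => X ^ ((1 : ℝ) - 1 / (Module.finrank ℚ K : ℝ)) := by
  classical
  have hfin : {q : Ideal (𝓞 K) | q.IsPrime ∧ q ∣ Q}.Finite := by
    have hf : Finite {q : Ideal (𝓞 K) // q ∣ Q} :=
      @Finite.of_fintype _ (UniqueFactorizationMonoid.fintypeSubtypeDvd Q hQ)
    exact Set.Finite.subset (s := {q : Ideal (𝓞 K) | q ∣ Q}) (Set.finite_coe_iff.mp hf) fun q hq => hq.2
  have hprime : ∀ p ∈ hfin.toFinset, Prime p := by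
    intro p hp
    obtain ⟨h1, h2⟩ := hfin.mem_toFinset.mp hp
    exact Ideal.prime_of_isPrime (ne_zero_of_dvd_ne_zero hQ h2) h1
  have hcop : ∀ J : Ideal (𝓞 K), IsCoprime J Q ↔ ∀ p ∈ hfin.toFinset, ¬ p ∣ J := by
    intro J
    constructor
    · intro h p hp hpJ
      obtain ⟨h1, h2⟩ := hfin.mem_toFinset.mp hp
      exact (hprime p hp).not_isUnit (h.isUnit_of_dvd' hpJ h2)
    · intro h
      rw [Ideal.isCoprime_iff_sup_eq]
      by_contra hne
      obtain ⟨m, hm, hle⟩ := Ideal.exists_le_maximal _ hne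
      exact h m (hfin.mem_toFinset.mpr ⟨hm.isPrime, Ideal.dvd_iff_le.mpr (le_sup_right.trans hle)⟩)
        (Ideal.dvd_iff_le.mpr (le_sup_left.trans hle))
  refine (sieve_count K hfin.toFinset hprime 𝒞).congr_left fun X => ?_
  rw [finprod_mem_eq_finite_toFinset_prod _ hfin]
  congr 2
  rw [← Nat.card_coe_set_eq]
  refine Nat.card_congr ⟨fun I => ⟨I.1.1, nonZeroDivisors.ne_zero I.1.2, I.2.1.1,
    (hcop _).mpr I.2.2, I.1.2, I.2.1.2⟩, fun J => ⟨⟨J.1, J.2.2.2.2.choose⟩,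
    ⟨J.2.2.1, J.2.2.2.2.choose_spec⟩, (hcop _).mp J.2.2.2.1⟩, fun I => rfl, fun J => rfl⟩

end
end

section
/- Let ℓ be an odd prime and K a number field containing the ℓ-th roots of unity. Then every realizable Steinitz class of a degree-ℓ cyclic extension of K lies in Cl(K)^{(ℓ−1)/2}, the subgroup of (ℓ−1)/2-th powers in the ideal class group of K: for every nonzero γ ∈ 𝒪_K with L = K(γ^{1/ℓ}) of degree ℓ over K, St(𝒪_L) ∈ Cl(K)^{(ℓ−1)/2}. -/
open NumberField
open scoped nonZeroDivisors

noncomputable section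

/-- `c` is the Steinitz class of `L/K`. -/
def IsSteinitzClass (K : Type*) [Field K] [NumberField K] (L : Type*) [Field L]
    [Algebra K L] (c : ClassGroup (𝓞 K)) : Prop :=
  ∃ I : (Ideal (𝓞 K))⁰, ClassGroup.mk0 I = c ∧
    Nonempty ((𝓞 L) ≃ₗ[𝓞 K] ((Fin (Module.finrank K L - 1) → 𝓞 K) × (I : Ideal (𝓞 K))))


theorem exists_det_ne_zero {M k : Type*} [Monoid M] [Field k] {n : ℕ} (χ : Fin n → (M →* k))
    (hχ : Function.Injective χ) :
    ∃ ω : Fin n → M, (Matrix.of fun i j => χ i (ω j)).det ≠ 0 := by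
  let v : M → (Fin n → k) := fun y i => χ i y
  have hspan : Submodule.span k (Set.range v) = ⊤ := by
    by_contra h
    obtain ⟨f, hf, hle⟩ := Submodule.exists_le_ker_of_lt_top _ (lt_top_iff_ne_top.mpr h)
    have hli := (linearIndependent_monoidHom M k).comp χ hχ
    rw [Fintype.linearIndependent_iff] at hli
    have h0 := hli (fun i => f (Pi.single i 1)) (by
      funext y
      have h1 : f (v y) = 0 := hle (Submodule.subset_span ⟨y, rfl⟩)
      rw [LinearMap.pi_apply_eq_sum_univ f (v y)] at h1
      simp only [Finset.sum_apply, Pi.smul_apply, smul_eq_mul, Function.comp, Pi.zero_apply]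
      rw [← h1]
      refine Finset.sum_congr rfl fun i _ => ?_
      simp only [smul_eq_mul, v]
      rw [mul_comm]
      congr 2
      ext j; simp [Pi.single_apply, eq_comm])
    apply hf
    ext i
    simpa using h0 i
  let b := Module.Basis.ofSpan hspan.ge
  have hb : ∀ i, ∃ y, v y = b i := fun i => Module.Basis.ofSpan_subset hspan.ge ⟨i, rfl⟩
  have hcard : Module.finrank k (Fin n → k) = n := by simp
  have := Module.Finite.finite_basis b
  have hc : Nat.card _ = n := (Module.finrank_eq_nat_card_basis b).symm.trans hcard
  let e := Finite.equivFinOfCardEq hc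
  choose ω hω using fun j : Fin n => hb (e.symm j)
  refine ⟨ω, ?_⟩
  have hli : LinearIndependent k (fun j => v (ω j)) := by
    have := b.linearIndependent.comp e.symm e.symm.injective
    have hfun : (fun j => v (ω j)) = ⇑b ∘ e.symm := funext hω
    rw [hfun]; exact this
  have := Matrix.linearIndependent_rows_iff_isUnit (A := Matrix.of fun j i => v (ω j) i)|>.mp hli
  rw [Matrix.isUnit_iff_isUnit_det, ← Matrix.det_transpose] at this
  exact this.ne_zero

/-- `m`-th power criterion. -/
theorem exists_eq_pow_of_forall {A : Type*} [CommRing A] [IsDedekindDomain A] (I : Ideal A)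
    (hI : I ≠ 0) (m : ℕ)
    (h : ∀ p : Ideal A, p.IsPrime → p ≠ ⊥ → ∃ k, I ≤ p ^ (m * k) ∧ ¬ I ≤ p ^ (m * k + 1)) :
    ∃ J : Ideal A, I = J ^ m := by
  choose! k hk1 hk2 using h
  have hmp : ∀ v : IsDedekindDomain.HeightOneSpectrum A,
      v.maxPowDividing I = (v.asIdeal ^ (k v.asIdeal)) ^ m := by
    intro v
    rw [IsDedekindDomain.HeightOneSpectrum.maxPowDividing_eq_pow_multiplicity hI, ← pow_mul]
    congr 1
    rw [mul_comm]
    apply multiplicity_eq_of_dvd_of_not_dvd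
    · exact Ideal.dvd_iff_le.mpr (hk1 _ v.isPrime v.ne_bot)
    · rw [Ideal.dvd_iff_le]; exact hk2 _ v.isPrime v.ne_bot
  by_cases hm : m = 0
  · subst hm
    refine ⟨1, ?_⟩
    rw [← Ideal.finprod_heightOneSpectrum_factorization hI]
    simp only [hmp, pow_zero, finprod_one]
  refine ⟨∏ᶠ v : IsDedekindDomain.HeightOneSpectrum A, v.asIdeal ^ (k v.asIdeal), ?_⟩
  rw [finprod_pow]
  · conv_lhs => rw [← Ideal.finprod_heightOneSpectrum_factorization hI]
    exact finprod_congr hmp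
  · refine (Ideal.hasFiniteMulSupport hI).subset fun v hv => ?_
    simp only [Function.mem_mulSupport, hmp] at hv ⊢
    contrapose! hv
    exact isUnit_iff_eq_one.mp ((isUnit_pow_iff hm).mp (hv ▸ isUnit_one))

section delta
variable {A B G : Type*} [CommRing A] [CommRing B] [Algebra A B] [Group G] [MulSemiringAction G B]

def Dlt {n : ℕ} (τ : Fin n ≃ G) (ω : Fin n → B) : B := (Matrix.of fun i j => τ i • ω j).det

theorem smul_Dlt {n : ℕ} (hn : Odd n) (τ : Fin n ≃ G) (ω : Fin n → B) (g : G) :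
    g • Dlt τ ω = Dlt τ ω := by
  have h1 : g • Dlt τ ω = (Matrix.of fun i j => (g * τ i) • ω j).det := by
    have := RingHom.map_det (MulSemiringAction.toRingHom G B g) (Matrix.of fun i j => τ i • ω j)
    simp only [MulSemiringAction.toRingHom_apply] at this
    rw [Dlt, this]
    congr 1
    ext i j
    simp [mul_smul]
  let σ : G → Equiv.Perm (Fin n) := fun g => (τ.trans (Equiv.mulLeft g)).trans τ.symm
  let f : G →* ℤˣ := ⟨⟨fun g => Equiv.Perm.sign (σ g), by
    have : σ 1 = 1 := by ext; simp [σ]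
    rw [this]; simp⟩, fun a b => by
      simp only
      rw [← map_mul]
      congr 1
      ext i; simp [σ]⟩
  have hsg : f g = 1 := by
    have hpow : f g ^ n = 1 := by
      rw [← map_pow]
      have : Nat.card G = n := by rw [← Nat.card_congr τ]; simp
      rw [← this, pow_card_eq_one', map_one]
    rcases Int.units_eq_one_or (f g) with h | h
    · exact h
    · rw [h, hn.neg_one_pow] at hpow
      rw [h]; exact hpow
  have h2 := Matrix.det_permute (σ g) (Matrix.of fun i j => τ i • ω j)
  have hsg' : Equiv.Perm.sign (σ g) = 1 := hsg
  rw [hsg'] at h2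
  rw [h1]
  simp only [Units.val_one, Int.cast_one, one_mul] at h2
  rw [Dlt, ← h2]
  congr 1
  ext i j
  simp [σ]

theorem Dlt_mem [IsGaloisGroup G A B] {n : ℕ} (hn : Odd n) (τ : Fin n ≃ G) (ω : Fin n → B) :
    ∃ a : A, algebraMap A B a = Dlt τ ω :=
  (IsGaloisGroup.isInvariant (G := G)).isInvariant _ (smul_Dlt hn τ ω)

/-- Unramified case. -/
theorem exists_Dlt_notMem {n : ℕ} (τ : Fin n ≃ G) (P : Ideal B) [P.IsPrime]
    (hP : ∀ g : G, g ≠ 1 → ∃ y : B, g • y - y ∉ P) : ∃ ω : Fin n → B, Dlt τ ω ∉ P := by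
  let q : B →+* FractionRing (B ⧸ P) := (algebraMap _ _).comp (Ideal.Quotient.mk P)
  have hq : ∀ y, q y = 0 ↔ y ∈ P := fun y => by
    simp [q, Ideal.Quotient.eq_zero_iff_mem]
  let χ : Fin n → (B →* FractionRing (B ⧸ P)) := fun i =>
    (q.comp (MulSemiringAction.toRingHom G B (τ i)) : B →+* _)
  obtain ⟨ω, hω⟩ := exists_det_ne_zero χ (by
    intro i j hij
    by_contra hne
    have hg : (τ i) * (τ j)⁻¹ ≠ 1 := by
      rw [Ne, mul_inv_eq_one]; exact fun h => hne (τ.injective h)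
    obtain ⟨y, hy⟩ := hP _ hg
    apply hy
    rw [← hq, map_sub, sub_eq_zero]
    have := DFunLike.congr_fun hij ((τ j)⁻¹ • y)
    simpa [χ, mul_smul] using this)
  refine ⟨ω, fun h => hω ?_⟩
  rw [← hq, Dlt, RingHom.map_det] at h
  rw [← h]
  congr 1

variable (A) in
/-- The ideal generated by all determinants. -/
def dIdeal {n : ℕ} (τ : Fin n ≃ G) : Ideal A :=
  Ideal.span {a : A | ∃ ω : Fin n → B, algebraMap A B a = Dlt τ ω}

theorem class_aux [IsDomain A] [IsDomain B] [IsGaloisGroup G A B] [FaithfulSMul A B] {n : ℕ} (hn : Odd (n + 1)) (τ : Fin (n + 1) ≃ G) (I : Ideal A)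
    (hI : I ≠ ⊥) (φ : B ≃ₗ[A] (Fin n → A) × I) :
    dIdeal A (B := B) τ ≠ ⊥ ∧
    ∃ x y : A, x ≠ 0 ∧ y ≠ 0 ∧ Ideal.span {x} * dIdeal A (B := B) τ = Ideal.span {y} * I := by
  have hinj : Function.Injective (algebraMap A B) := FaithfulSMul.algebraMap_injective A B
  have := IsGaloisGroup.commutes (G := G) (A := A) (B := B)
  have := IsGaloisGroup.faithful (G := G) A (B := B)
  obtain ⟨a0, ha0, hne⟩ := Submodule.exists_mem_ne_zero_of_ne_bot hI
  let e : Fin n → B := fun j => φ.symm (Pi.single j 1, 0)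
  let s : I → B := fun a => φ.symm (0, a)
  let w : I → Fin (n + 1) → B := fun a => Fin.snoc e (s a)
  have hs : ∀ a : I, a0 • s a = (a : A) • s ⟨a0, ha0⟩ := by
    intro a
    simp only [s, ← map_smul]
    congr 1
    ext
    · simp
    · simp [mul_comm]
  obtain ⟨d, hd⟩ := Dlt_mem (A := A) hn τ (w ⟨a0, ha0⟩)
  have hexp : ∀ y : B, y = (∑ j, (φ y).1 j • e j) + s (φ y).2 := by
    intro y
    apply φ.injective
    simp only [map_add, map_sum, map_smul, e, s, LinearEquiv.apply_symm_apply]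
    ext
    · simp [Prod.fst_sum, Finset.sum_apply, Pi.single_apply]
    · simp [Prod.snd_sum]
  -- first inclusion
  have h1 : ∀ a : I, algebraMap A B (a * d) = algebraMap A B a0 * Dlt τ (w a) := by
    intro a
    rw [map_mul, hd, Dlt, Dlt]
    have e1 : ∀ (r : A) (b : I), algebraMap A B r * (Matrix.of fun i j => τ i • w b j).det
        = ((Matrix.of fun i j => τ i • w b j).updateCol (Fin.last n) (fun i => τ i • (r • s b))).det := by
      intro r b
      have : (fun i => τ i • (r • s b)) =
          algebraMap A B r • (fun i => (Matrix.of fun i j => τ i • w b j) i (Fin.last n)) := by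
        funext i
        simp only [Pi.smul_apply, Matrix.of_apply, smul_eq_mul, w, Fin.snoc_last]
        rw [smul_comm, Algebra.smul_def]
      rw [this, Matrix.det_updateCol_smul]
      congr 2
      exact (Matrix.updateCol_eq_self _ _).symm
    rw [e1, e1, hs]
    congr 1
    ext i j
    refine Fin.lastCases ?_ (fun j => ?_) j
    · simp
    · simp [w, (Fin.castSucc_lt_last j).ne]
  -- second
  have h2 : ∀ ω : Fin (n + 1) → B, ∃ c ∈ I, algebraMap A B a0 * Dlt τ ω = algebraMap A B (d * c) := by
    intro ω
    let C : Matrix (Fin (n + 1)) (Fin (n + 1)) A :=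
      Matrix.of fun k j => Fin.snoc (α := fun _ => A) (φ (ω j)).1 ((φ (ω j)).2 : A) k
    let D : Matrix (Fin (n + 1)) (Fin (n + 1)) A :=
      Matrix.diagonal (Fin.snoc (α := fun _ => A) (fun _ => a0) 1)
    have hC : C.det ∈ I := by
      rw [Matrix.det_succ_row C (Fin.last n)]
      refine Ideal.sum_mem _ fun j _ => ?_
      refine I.mul_mem_right _ (I.mul_mem_left _ ?_)
      simp [C]
    have hmat : (algebraMap A B a0) • (Matrix.of fun i j => τ i • ω j) =
        (Matrix.of fun i j => τ i • w ⟨a0, ha0⟩ j) * (D * C).map (algebraMap A B) := by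
      ext i j
      rw [Matrix.mul_apply, Fin.sum_univ_castSucc]
      simp only [Matrix.smul_apply, Matrix.of_apply, smul_eq_mul, Matrix.map_apply, D, C,
        Matrix.diagonal_mul, w, Fin.snoc_castSucc, Fin.snoc_last, one_mul]
      conv_lhs => rw [hexp (ω j)]
      rw [smul_add, mul_add, Finset.smul_sum, Finset.mul_sum]
      congr 1
      · refine Finset.sum_congr rfl fun k _ => ?_
        rw [smul_comm, Algebra.smul_def, map_mul]; ring
      · rw [← Algebra.smul_def, ← smul_comm, hs, smul_comm, Algebra.smul_def, mul_comm]
    refine ⟨C.det, hC, ?_⟩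
    have := congrArg Matrix.det hmat
    rw [Matrix.det_smul, Matrix.det_mul, ← RingHom.mapMatrix_apply, ← RingHom.map_det,
      Matrix.det_mul, Matrix.det_diagonal, Fin.prod_univ_castSucc] at this
    simp only [Fin.snoc_castSucc, Fin.snoc_last, mul_one, Finset.prod_const, Finset.card_univ,
      Fintype.card_fin] at this
    have hne' : algebraMap A B a0 ^ n ≠ 0 := pow_ne_zero _ (by
      rwa [Ne, map_eq_zero_iff _ hinj])
    apply mul_left_cancel₀ hne'
    rw [map_mul, hd]
    simp only [Dlt]
    rw [map_mul, map_pow] at this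
    linear_combination this
  obtain ⟨ω0, hω0⟩ := exists_Dlt_notMem τ (⊥ : Ideal B) (by
    intro g hg
    by_contra! h
    apply hg
    apply FaithfulSMul.eq_of_smul_eq_smul (α := B)
    intro y
    have := h y
    rw [Ideal.mem_bot, sub_eq_zero] at this
    rw [this, one_smul])
  rw [Ideal.mem_bot] at hω0
  obtain ⟨t, ht⟩ := Dlt_mem (A := A) hn τ ω0
  have hd0 : d ≠ 0 := by
    rintro rfl
    obtain ⟨c, -, hc⟩ := h2 ω0
    rw [zero_mul, map_zero, mul_eq_zero, map_eq_zero_iff _ hinj] at hc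
    exact hc.elim hne hω0
  refine ⟨fun h => ?_, a0, d, hne, hd0, ?_⟩
  · have : t ∈ dIdeal A (B := B) τ := Ideal.subset_span ⟨ω0, ht⟩
    rw [h, Ideal.mem_bot] at this
    subst this
    exact hω0 (by rw [← ht, map_zero])
  · apply le_antisymm
    · rw [dIdeal, Ideal.span_mul_span', Ideal.span_le]
      rintro _ ⟨x, hx, y, ⟨ω, hω⟩, rfl⟩
      obtain ⟨c, hc, hc2⟩ := h2 ω
      rw [Set.mem_singleton_iff] at hx
      subst hx
      rw [← hω, ← map_mul] at hc2
      simp only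
      rw [hinj hc2]
      exact Ideal.mul_mem_mul (Ideal.mem_span_singleton_self d) hc
    · rw [Ideal.span_singleton_mul_le_iff]
      intro a ha
      obtain ⟨z, hz⟩ := Dlt_mem (A := A) hn τ (w ⟨a, ha⟩)
      have := h1 ⟨a, ha⟩
      rw [← hz, ← map_mul] at this
      have h3 := hinj this
      simp only at h3
      rw [mul_comm d a, h3]
      exact Ideal.mul_mem_mul (Ideal.mem_span_singleton_self _) (Ideal.subset_span ⟨_, hz⟩)
theorem ram_case [IsDedekindDomain A] [IsDedekindDomain B] [IsGaloisGroup G A B] [FaithfulSMul A B]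
    {ℓ m : ℕ} (hℓ : ℓ.Prime) (hm : ℓ = 2 * m + 1) (τ : Fin ℓ ≃ G) (p : Ideal A) (P : Ideal B)
    [P.IsPrime] (hp : p.IsPrime) (hp0 : p ≠ ⊥) (hP0 : P ≠ ⊥) [hlo : P.LiesOver p]
    (hin : ∀ (g : G) (y : B), g • y - y ∈ P)
    (hsurj : ∀ y : B, ∃ a : A, y - algebraMap A B a ∈ P)
    (hram : ∀ I : Ideal A, I ≠ ⊥ →
      emultiplicity P (I.map (algebraMap A B)) = ℓ * emultiplicity p I) :
    ∃ k, dIdeal A (B := B) τ ≤ p ^ (m * k) ∧ ¬ dIdeal A (B := B) τ ≤ p ^ (m * k + 1) := by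
  have hinj : Function.Injective (algebraMap A B) := FaithfulSMul.algebraMap_injective A B
  have hcomm := IsGaloisGroup.commutes (G := G) (A := A) (B := B)
  have hfaith := IsGaloisGroup.faithful (G := G) A (B := B)
  have hinv := IsGaloisGroup.isInvariant (G := G) (A := A) (B := B)
  have hodd : Odd ℓ := ⟨m, hm⟩
  have hcard : Nat.card G = ℓ := by rw [← Nat.card_congr τ]; simp
  have hfin : Finite G := Finite.of_equiv _ τ
  have hpr : Prime P := (Ideal.prime_iff_isPrime hP0).mpr inferInstance
  let v : B → ℕ∞ := fun y => emultiplicity P (Ideal.span {y})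
  have hv : ∀ (y : B) (j : ℕ), y ∈ P ^ j ↔ (j : ℕ∞) ≤ v y := fun y j => by
    rw [← pow_dvd_iff_le_emultiplicity, Ideal.dvd_span_singleton]
  have hvm : ∀ y z, v (y * z) = v y + v z := fun y z => by
    simp only [v]
    rw [← Ideal.span_singleton_mul_span_singleton, emultiplicity_mul hpr]
  have hsm : ∀ (g : G) (j : ℕ) (y : B), y ∈ P ^ j → g • y ∈ P ^ j := by
    intro g j y hy
    have h1 : P ≤ P.comap (MulSemiringAction.toRingHom G B g) := fun z hz => by
      have := P.add_mem (hin g z) hz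
      simpa using this
    have h2 := (Ideal.pow_right_mono h1 j).trans (Ideal.le_comap_pow _ j)
    exact h2 hy
  have hsm' : ∀ (g : G) (j : ℕ) (y : B), g • y ∈ P ^ j ↔ y ∈ P ^ j := fun g j y =>
    ⟨fun h => by simpa using hsm g⁻¹ j _ h, hsm g j y⟩
  have hvs : ∀ (g : G) y, v (g • y) = v y := fun g y => by
    apply emultiplicity_eq_emultiplicity_iff.mpr
    intro j
    rw [Ideal.dvd_span_singleton, Ideal.dvd_span_singleton, hsm']
  have hvA : ∀ a : A, a ≠ 0 → v (algebraMap A B a) = ℓ * emultiplicity p (Ideal.span {a}) := by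
    intro a ha
    rw [← hram _ (by simpa using ha), Ideal.map_span, Set.image_singleton]
  -- uniformizer
  obtain ⟨π, hπ1, hπ2⟩ : ∃ π ∈ P, π ∉ P ^ 2 := by
    have hlt : P ^ 2 < P := by
      have := Ideal.pow_right_strictAnti P hP0 (Ideal.IsPrime.ne_top inferInstance)
        (show 1 < 2 by norm_num)
      simpa using this
    exact SetLike.exists_of_lt hlt
  have hvπ : v π = 1 := by
    apply le_antisymm
    · by_contra h
      push Not at h
      have h' := Order.add_one_le_of_lt h
      rw [one_add_one_eq_two] at h'
      exact hπ2 ((hv _ _).mpr h')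
    · simpa using (hv π 1).mp (by simpa using hπ1)
  have hvπn : ∀ j : ℕ, v (π ^ j) = j := by
    intro j
    simp only [v] at hvπ ⊢
    rw [← Ideal.span_singleton_pow, emultiplicity_pow hpr, hvπ, mul_one]
  have happrox : ∀ (N : ℕ) (y : B), ∃ q : Polynomial A, y - Polynomial.aeval π q ∈ P ^ N := by
    intro N
    induction N with
    | zero => intro y; exact ⟨0, by simp⟩
    | succ N ih =>
      intro y
      obtain ⟨q, hq⟩ := ih y
      obtain ⟨d, e, he, hde⟩ := Ideal.exists_mul_add_mem_pow_succ hP0 (π ^ N)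
        (y - Polynomial.aeval π q) ((hv _ _).mpr (hvπn N).ge) (fun h => by
          have := (hv _ _).mp h
          rw [hvπn, Nat.cast_le] at this
          omega) hq
      obtain ⟨a, ha⟩ := hsurj d
      refine ⟨q + Polynomial.C a * Polynomial.X ^ N, ?_⟩
      have : y - Polynomial.aeval π (q + Polynomial.C a * Polynomial.X ^ N) =
          π ^ N * (d - algebraMap A B a) + e := by
        simp only [map_add, map_mul, map_pow, Polynomial.aeval_C, Polynomial.aeval_X]
        linear_combination -hde
      rw [this]
      refine Ideal.add_mem _ ?_ he
      rw [pow_succ]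
      exact Ideal.mul_mem_mul ((hv _ _).mpr (hvπn N).ge) ha
  have happrox' : ∀ (N : ℕ) (y : B), ∃ c : Fin ℓ → A, y - ∑ i, c i • π ^ (i : ℕ) ∈ P ^ N := by
    intro N y
    obtain ⟨q, hq⟩ := happrox N y
    have := Fintype.ofFinite G
    obtain ⟨f, hf1, hf2, hf3⟩ := Polynomial.lifts_and_natDegree_eq_and_monic
      (Algebra.IsInvariant.charpoly_mem_lifts A B G π) (MulSemiringAction.monic_charpoly G π)
    have hdeg : f.natDegree = ℓ := by
      rw [hf2, ← hcard, MulSemiringAction.charpoly, Polynomial.natDegree_prod_of_monic _ _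
        (fun g _ => Polynomial.monic_X_sub_C _), Nat.card_eq_fintype_card]
      simp
    have hroot : Polynomial.aeval π f = 0 := by
      rw [Polynomial.aeval_def, ← Polynomial.eval_map, hf1]
      exact MulSemiringAction.eval_charpoly G π
    refine ⟨fun i => (q %ₘ f).coeff i, ?_⟩
    have h1 : Polynomial.aeval π q = Polynomial.aeval π (q %ₘ f) := by
      conv_lhs => rw [← Polynomial.modByMonic_add_div q f]
      simp [hroot]
    have hlt : (q %ₘ f).natDegree < ℓ := by
      rw [← hdeg]
      apply Polynomial.natDegree_modByMonic_lt _ hf3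
      rintro rfl
      simp at hdeg
      exact hℓ.one_lt.ne (by omega)
    rw [h1, Polynomial.aeval_eq_sum_range' hlt, Finset.sum_range] at hq
    exact hq
  have hzp : ∀ g h : G, g ≠ 1 → ∃ j : ℕ, g ^ j = h := by
    intro g h hg
    have : Fact ℓ.Prime := ⟨hℓ⟩
    have := mem_powers_of_prime_card hcard hg (g' := h)
    exact this
  have hmv : ∀ g h : G, g ≠ 1 → ∀ j : ℕ, g • π - π ∈ P ^ j → h • π - π ∈ P ^ j := by
    intro g h hg j hj
    obtain ⟨t, rfl⟩ := hzp g h hg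
    induction t with
    | zero => simp
    | succ t ih =>
      have : g ^ (t + 1) • π - π = g ^ t • (g • π - π) + (g ^ t • π - π) := by
        rw [pow_succ, mul_smul, smul_sub]; ring
      rw [this]
      exact Ideal.add_mem _ (hsm _ _ _ hj) ih
  have hfix : ∀ g : G, g ≠ 1 → g • π ≠ π := by
    intro g hg hgπ
    have hall : ∀ h : G, h • π = π := by
      intro h
      obtain ⟨t, rfl⟩ := hzp g h hg
      induction t with
      | zero => simp
      | succ t ih => rw [pow_succ, mul_smul, hgπ, ih]
    obtain ⟨a, ha⟩ := hinv.isInvariant π hall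
    have hap : a ∈ p := by
      rw [hlo.over, Ideal.mem_comap, ha]; exact hπ1
    have ha0 : a ≠ 0 := by
      rintro rfl
      rw [map_zero] at ha
      exact hπ2 (ha ▸ Ideal.zero_mem _)
    have h1 := hvA a ha0
    have h2 : (1 : ℕ∞) ≤ emultiplicity p (Ideal.span {a}) := by
      have : p ^ 1 ∣ Ideal.span {a} := by rw [pow_one, Ideal.dvd_span_singleton]; exact hap
      simpa using pow_dvd_iff_le_emultiplicity.mp this
    rw [ha, hvπ] at h1
    have h3 : (ℓ : ℕ∞) * 1 ≤ 1 := (mul_le_mul_right h2 _).trans h1.ge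
    rw [mul_one] at h3
    have : ℓ ≤ 1 := by exact_mod_cast h3
    exact absurd hℓ.one_lt (by omega)
  have hnt : Nontrivial G := Finite.one_lt_card_iff_nontrivial.mp (hcard ▸ hℓ.one_lt)
  obtain ⟨g0, hg0⟩ := exists_ne (1 : G)
  have hfm : FiniteMultiplicity P (Ideal.span {g0 • π - π}) :=
    FiniteMultiplicity.of_prime_left hpr (by
      simpa [Ideal.zero_eq_bot, sub_eq_zero] using hfix g0 hg0)
  obtain ⟨k, hk⟩ : ∃ k : ℕ, v (g0 • π - π) = k := ⟨_, hfm.emultiplicity_eq_multiplicity⟩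
  have hkall : ∀ g : G, g ≠ 1 → v (g • π - π) = k := by
    intro g hg
    rw [← hk]
    apply emultiplicity_eq_emultiplicity_iff.mpr
    intro j
    rw [Ideal.dvd_span_singleton, Ideal.dvd_span_singleton]
    exact ⟨hmv g g0 hg j, hmv g0 g hg0 j⟩
  let W : Fin ℓ → B := fun j => π ^ (j : ℕ)
  have hVand : v (Dlt τ W) = (ℓ * (m * k) : ℕ) := by
    have h1 : Dlt τ W = ∏ i : Fin ℓ, ∏ j ∈ Finset.Ioi i, (τ j • π - τ i • π) := by
      rw [← Matrix.det_vandermonde]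
      simp only [Dlt]
      congr 1
      ext i j
      simp [W, Matrix.vandermonde_apply]
    have h2 : ∀ i j : Fin ℓ, j ≠ i → v (τ j • π - τ i • π) = k := by
      intro i j hij
      rw [← hkall ((τ i)⁻¹ * τ j) (by
        rw [Ne, inv_mul_eq_one]; exact fun h => hij (τ.injective h.symm)), ← hvs (τ i) (((τ i)⁻¹ * τ j) • π - π)]
      simp [smul_sub, mul_smul]
    have hvp : ∀ {ι : Type} (s : Finset ι) (f : ι → B), v (∏ i ∈ s, f i) = ∑ i ∈ s, v (f i) := by
      intro ι s f
      simp only [v]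
      rw [← Ideal.prod_span_singleton, Finset.emultiplicity_prod hpr]
    rw [h1, hvp]
    have h3 : ∀ i : Fin ℓ, v (∏ j ∈ Finset.Ioi i, (τ j • π - τ i • π)) =
        (((ℓ - 1 - i) * k : ℕ) : ℕ∞) := by
      intro i
      rw [hvp, Finset.sum_congr rfl (fun j hj => h2 i j (Finset.mem_Ioi.mp hj).ne'),
        Finset.sum_const, Fin.card_Ioi]
      simp
    rw [Finset.sum_congr rfl fun i _ => h3 i, ← Nat.cast_sum, ← Finset.sum_mul, ← mul_assoc]
    congr 2
    rw [Fin.sum_univ_eq_sum_range (fun i => ℓ - 1 - i) ℓ, Finset.sum_range_reflect (fun i => i) ℓ,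
      Finset.sum_range_id, hm]
    rw [show 2 * m + 1 - 1 = m * 2 by omega, ← mul_assoc, Nat.mul_div_cancel _ two_pos]
  have hall : ∀ ω : Fin ℓ → B, Dlt τ ω ∈ P ^ (ℓ * (m * k)) := by
    intro ω
    choose c hc using fun j => happrox' (ℓ * (m * k)) (ω j)
    let ω' : Fin ℓ → B := fun j => ∑ i, c j i • π ^ (i : ℕ)
    have h1 : Dlt τ ω' = Dlt τ W * algebraMap A B (Matrix.of fun i j => c j i).det := by
      rw [RingHom.map_det, Dlt, Dlt, ← Matrix.det_mul]
      congr 1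
      ext i j
      rw [Matrix.mul_apply]
      simp only [Matrix.of_apply, ω', Finset.smul_sum, W, RingHom.mapMatrix_apply,
        Matrix.map_apply]
      refine Finset.sum_congr rfl fun t _ => ?_
      rw [smul_comm, Algebra.smul_def, mul_comm]
    have h2 : Ideal.Quotient.mk (P ^ (ℓ * (m * k))) (Dlt τ ω) =
        Ideal.Quotient.mk (P ^ (ℓ * (m * k))) (Dlt τ ω') := by
      rw [Dlt, Dlt, RingHom.map_det, RingHom.map_det]
      congr 1
      ext i j
      simp only [RingHom.mapMatrix_apply, Matrix.map_apply, Matrix.of_apply]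
      rw [Ideal.Quotient.eq, ← smul_sub]
      exact hsm _ _ _ (hc j)
    rw [← Ideal.Quotient.eq_zero_iff_mem, h2, Ideal.Quotient.eq_zero_iff_mem, h1]
    exact Ideal.mul_mem_right _ _ ((hv _ _).mpr hVand.ge)
  have hℓ0 : 0 < ℓ := hℓ.pos
  refine ⟨k, ?_, ?_⟩
  · rw [dIdeal, Ideal.span_le]
    rintro a ⟨ω, hω⟩
    by_cases ha : a = 0
    · rw [ha]; exact Ideal.zero_mem _
    have h1 := (hv _ _).mp (hall ω)
    rw [← hω, hvA a ha] at h1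
    have h2 : ((m * k : ℕ) : ℕ∞) ≤ emultiplicity p (Ideal.span {a}) := by
      generalize emultiplicity p (Ideal.span {a}) = t at h1
      induction t using ENat.recTopCoe with
      | top => exact le_top
      | coe t =>
        have h3 : ℓ * (m * k) ≤ ℓ * t := by exact_mod_cast h1
        exact_mod_cast Nat.le_of_mul_le_mul_left h3 hℓ0
    rw [← pow_dvd_iff_le_emultiplicity, Ideal.dvd_span_singleton] at h2
    exact h2
  · intro hle
    obtain ⟨a, ha⟩ := Dlt_mem (A := A) hodd τ W
    have h1 : a ∈ p ^ (m * k + 1) := hle (Ideal.subset_span ⟨W, ha⟩)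
    rw [← Ideal.dvd_span_singleton, pow_dvd_iff_le_emultiplicity] at h1
    have ha0 : a ≠ 0 := by
      rintro rfl
      rw [← ha, map_zero] at hVand
      simp only [v, Ideal.span_singleton_zero, ← Ideal.zero_eq_bot, emultiplicity_zero] at hVand
      exact ENat.top_ne_natCast _ hVand
    rw [← ha, hvA a ha0] at hVand
    have h2 : (ℓ : ℕ∞) * ((m * k + 1 : ℕ) : ℕ∞) ≤ (ℓ * (m * k) : ℕ) := by
      rw [← hVand]; gcongr
    have h3 : ℓ * (m * k + 1) ≤ ℓ * (m * k) := by exact_mod_cast h2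
    have := Nat.le_of_mul_le_mul_left h3 hℓ0
    omega
end delta


theorem dIdeal_local (K L : Type*) [Field K] [NumberField K] [Field L] [NumberField L] [Algebra K L]
    [IsGalois K L] {ℓ m : ℕ} (hℓ : ℓ.Prime) (hm : ℓ = 2 * m + 1) (τ : Fin ℓ ≃ Gal(L/K))
    (p : Ideal (𝓞 K)) (hp : p.IsPrime) (hp0 : p ≠ ⊥) :
    ∃ k, dIdeal (𝓞 K) (B := 𝓞 L) τ ≤ p ^ (m * k) ∧
      ¬ dIdeal (𝓞 K) (B := 𝓞 L) τ ≤ p ^ (m * k + 1) := by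
  obtain ⟨⟨P, hPp, hlo⟩⟩ := (inferInstance : Nonempty (p.primesOver (𝓞 L)))
  have hpm : p.IsMaximal := hp.isMaximal hp0
  have hPm : P.IsMaximal := Ideal.IsMaximal.of_liesOver_isMaximal P p
  have hP0 : P ≠ ⊥ := Ideal.ne_bot_of_liesOver_of_ne_bot hp0 P
  have hcard : Nat.card Gal(L/K) = ℓ := by rw [← Nat.card_congr τ]; simp
  have hfinq : Finite (𝓞 K ⧸ p) := Ideal.finiteQuotientOfFreeOfNeBot p hp0
  have hfinQ : Finite (𝓞 L ⧸ P) := Ideal.finiteQuotientOfFreeOfNeBot P hP0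
  have hfinr : Finite p.ResidueField :=
    Finite.of_surjective _ p.bijective_algebraMap_quotient_residueField.2
  have hGal : IsGaloisGroup Gal(L/K) (𝓞 K) (𝓞 L) := inferInstance
  have hfact : Fact ℓ.Prime := ⟨hℓ⟩
  have hfact' : Fact (Nat.card Gal(L/K)).Prime := ⟨hcard ▸ hℓ⟩
  rcases (P.inertia Gal(L/K)).eq_bot_or_eq_top_of_prime_card with hI | hI
  · have hodd : Odd ℓ := ⟨m, hm⟩
    obtain ⟨ω, hω⟩ := exists_Dlt_notMem τ P (by
      intro g hg
      by_contra! h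
      apply hg
      have : g ∈ P.inertia Gal(L/K) := h
      rwa [hI, Subgroup.mem_bot] at this)
    obtain ⟨a, ha⟩ := Dlt_mem (A := 𝓞 K) hodd τ ω
    refine ⟨0, by simp, fun hle => hω ?_⟩
    have : a ∈ p := by simpa using hle (Ideal.subset_span ⟨ω, ha⟩)
    rw [hlo.over, Ideal.mem_comap, ha] at this
    exact this
  · have hIc : Nat.card (P.inertia Gal(L/K)) = ℓ := by
      rw [hI, ← hcard]; exact Subgroup.card_top
    have he : p.ramificationIdx' P = ℓ := by
      rw [Ideal.ramificationIdx'_eq_ramificationIdx p P hp0,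
        ← Ideal.ramificationIdxIn_eq_ramificationIdx p P Gal(L/K),
        ← Ideal.card_inertia_eq_ramificationIdxIn (G := Gal(L/K)) p P, hIc]
    have hf : P.inertiaDeg (𝓞 K) = 1 := by
      have h1 := Ideal.ncard_primesOver_mul_card_inertia_mul_finrank (G := Gal(L/K)) p P
      rw [hIc, hcard] at h1
      have h2 : ℓ * ((p.primesOver (𝓞 L)).ncard * P.inertiaDeg (𝓞 K)) = ℓ * 1 := by
        rw [mul_one]; conv_rhs => rw [← h1]
        ring
      exact Nat.eq_one_of_mul_eq_one_left (Nat.eq_of_mul_eq_mul_left hℓ.pos h2)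
    refine ram_case hℓ hm τ p P hp hp0 hP0 ?_ ?_ ?_
    · intro g y
      have : g ∈ P.inertia Gal(L/K) := by rw [hI]; trivial
      exact this y
    · have h1 := Ideal.cardQuot_pow_inertiaDeg p P
      rw [hf, pow_one] at h1
      have hinj : Function.Injective (algebraMap (𝓞 K ⧸ p) (𝓞 L ⧸ P)) :=
        FaithfulSMul.algebraMap_injective _ _
      have hbij := (Nat.bijective_iff_injective_and_card _).mpr ⟨hinj, h1⟩
      intro y
      obtain ⟨z, hz⟩ := hbij.2 (Ideal.Quotient.mk P y)
      obtain ⟨a, rfl⟩ := Ideal.Quotient.mk_surjective z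
      refine ⟨a, ?_⟩
      rw [← Ideal.Quotient.eq, ← hz]
      rfl
    · intro I hI0
      rw [Ideal.IsDedekindDomain.emultiplicity_map_eq_ramificationIdx'_mul hI0 (v := p) ?_ ?_ hP0, he]
      · exact ((Ideal.prime_iff_isPrime hp0).mpr hp).irreducible
      · exact ((Ideal.prime_iff_isPrime hP0).mpr hPp).irreducible

/-- **Realizable Steinitz classes of `ℓ`-Kummer extensions are `(ℓ-1)/2`-th powers.**
Let `ℓ` be an odd prime and `K` a number field containing the `ℓ`-th roots of unity.
For every nonzero `γ ∈ 𝒪_K` with `L = K(γ^(1/ℓ))` of degree `ℓ`, the Steinitz class of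
`L/K` lies in the subgroup `Cl(K)^((ℓ-1)/2)` of `(ℓ-1)/2`-th powers. -/
theorem realizable_steinitz_classes_are_powers
    (ℓ : ℕ) (hℓ : ℓ.Prime) (hodd : Odd ℓ)
    (K : Type*) [Field K] [NumberField K]
    (hζ : ∃ ζ : K, IsPrimitiveRoot ζ ℓ)
    (L : Type*) [Field L] [Algebra K L]
    (γ : 𝓞 K) (hγ : γ ≠ 0) (x : L)
    (hx : x ^ ℓ = algebraMap K L (algebraMap (𝓞 K) K γ))
    (hgen : IntermediateField.adjoin K {x} = ⊤)
    (hdeg : Module.finrank K L = ℓ) :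
    ∀ c : ClassGroup (𝓞 K), IsSteinitzClass K L c →
      c ∈ (powMonoidHom ((ℓ - 1) / 2) :
        ClassGroup (𝓞 K) →* ClassGroup (𝓞 K)).range := by
  intro c hc
  have hfd : FiniteDimensional K L := Module.finite_of_finrank_pos (hdeg ▸ hℓ.pos)
  have hcz : CharZero L := charZero_of_injective_algebraMap (algebraMap K L).injective
  have hnf : NumberField L := NumberField.of_module_finite K L
  have hgal : IsGalois K L := by
    have hK : (primitiveRoots (Module.finrank K L) K).Nonempty := by
      obtain ⟨ζ, h⟩ := hζ
      exact ⟨ζ, (mem_primitiveRoots (hdeg ▸ hℓ.pos)).mpr (hdeg ▸ h)⟩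
    have h3 : ∃ α : L, α ^ (Module.finrank K L) ∈ Set.range (algebraMap K L) ∧
        IntermediateField.adjoin K {α} = ⊤ := ⟨x, ⟨_, by rw [hdeg]; exact hx.symm⟩, hgen⟩
    have h1 : IsGalois K L ∧ IsCyclic Gal(L/K) := ((isCyclic_tfae K L hK).out 0 2).mpr h3
    exact h1.1
  obtain ⟨m, hm⟩ := hodd
  have hcard : Nat.card Gal(L/K) = ℓ := by rw [IsGalois.card_aut_eq_finrank, hdeg]
  obtain ⟨I, rfl, ⟨φ⟩⟩ := hc
  have hfr : Module.finrank K L - 1 = 2 * m := by omega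
  rw [hfr] at φ
  subst hm
  let τ : Fin (2 * m + 1) ≃ Gal(L/K) := (Finite.equivFinOfCardEq hcard).symm
  obtain ⟨hne, a, b, ha, hb, hab⟩ := class_aux (A := 𝓞 K) (show Odd (2 * m + 1) from ⟨m, rfl⟩) τ (I : Ideal (𝓞 K))
    (nonZeroDivisors.ne_zero I.2) φ
  obtain ⟨J, hJ⟩ := exists_eq_pow_of_forall (dIdeal (𝓞 K) (B := 𝓞 L) τ) hne m
    (fun p hp hp0 => dIdeal_local K L hℓ rfl τ p hp hp0)
  have hm0 : m ≠ 0 := by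
    rintro rfl
    exact hℓ.one_lt.ne rfl
  have hJ0 : J ≠ 0 := by
    rintro rfl
    exact hne (by rw [hJ, zero_pow hm0]; rfl)
  let J' : (Ideal (𝓞 K))⁰ := ⟨J, mem_nonZeroDivisors_of_ne_zero hJ0⟩
  refine ⟨ClassGroup.mk0 J', ?_⟩
  have hmm : (2 * m + 1 - 1) / 2 = m := by omega
  rw [hmm, powMonoidHom_apply, ← map_pow, ClassGroup.mk0_eq_mk0_iff]
  refine ⟨a, b, ha, hb, ?_⟩
  rw [← hab, hJ]
  rfl

end
end
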